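/- arXiv:1303.6925 — 2 statements merged into one kernel-verified Lean document; each statement's English description precedes it below -/
import Mathlib

section
/- Let E, S be filtered Polish spaces, η ∈ P(E), ν ∈ P(S), and c : E×S → [0,∞] lower semicontinuous. Then there exists γ* ∈ Π_c(η,ν) attaining the infimum of ∫_{E×S} c dγ over all causal transference plans γ ∈ Π_c(η,ν). -/
open MeasureTheory ProbabilityTheory Filter Set Topology
open scoped ENNReal NNReal

noncomputable section

/-- The augmentation of a sub-σ-field `m` by the `η`-null sets. -/
def aug {α : Type*} [MeasurableSpace α] (η : Measure α) (m : MeasurableSpace α) :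
    MeasurableSpace α :=
  m ⊔ MeasurableSpace.generateFrom {s : Set α | η s = 0}

/-- `Θ` is a conditional probability kernel of `γ` with respect to `η`. -/
def IsCondKernel {E S : Type*} [MeasurableSpace E] [MeasurableSpace S]
    (η : Measure E) (γ : Measure (E × S)) (Θ : Kernel E S) : Prop :=
  IsMarkovKernel Θ ∧ ∀ A B, MeasurableSet A → MeasurableSet B →
    γ (A ×ˢ B) = ∫⁻ ω in A, Θ ω B ∂η

/-- A plan `γ` on `E × S` with first marginal `η` is causal for the filtrations
`ℱE`, `ℱS` if it admits a conditional kernel `Θ` with respect to `η` such that for every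
`t` and every `C ∈ ℱS t`, `ω ↦ Θ ω C` is measurable for the `η`-augmentation of `ℱE t`. -/
def CausalPlan {E S : Type*} [MeasurableSpace E] [MeasurableSpace S]
    (ℱE : unitInterval → MeasurableSpace E) (ℱS : unitInterval → MeasurableSpace S)
    (η : Measure E) (γ : Measure (E × S)) : Prop :=
  γ.fst = η ∧ ∃ Θ : Kernel E S, IsCondKernel η γ Θ ∧
    ∀ t : unitInterval, ∀ C : Set S, MeasurableSet[ℱS t] C →
      Measurable[aug η (ℱE t)] (fun ω => Θ ω C)

section StaircaseApproximation

lemma sum_staircase_le (ε x : ℝ≥0∞) (n : ℕ) :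
    ∑ k ∈ Finset.range n, (if (k + 1) * ε < x then ε else 0) ≤ x := by
  induction n with
  | zero => simp
  | succ n ih =>
    rw [Finset.sum_range_succ]
    split_ifs with h
    · refine le_trans ?_ h.le
      rw [add_mul, one_mul]
      gcongr
      calc ∑ k ∈ Finset.range n, (if (k + 1) * ε < x then ε else 0)
          ≤ ∑ k ∈ Finset.range n, ε := by
            gcongr with k
            split_ifs <;> simp
        _ = n * ε := by simp
    · simpa using ih

lemma tsum_staircase_le (ε x : ℝ≥0∞) :
    ∑' k : ℕ, (if (k + 1) * ε < x then ε else 0) ≤ x := by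
  rw [ENNReal.tsum_eq_iSup_nat]
  exact iSup_le (sum_staircase_le ε x)

lemma le_tsum_staircase_add {ε : ℝ≥0} (hε : 0 < ε) (x : ℝ≥0∞) :
    x ≤ ∑' k : ℕ, (if (k + 1) * (ε : ℝ≥0∞) < x then (ε : ℝ≥0∞) else 0) + ε := by
  have hε0 : (ε : ℝ≥0∞) ≠ 0 := by simpa using hε.ne'
  have hlt (k : ℕ) : (k + 1) * (ε : ℝ≥0∞) < ∞ :=
    ENNReal.mul_lt_top (by simp) ENNReal.coe_lt_top
  rcases eq_or_ne x ∞ with rfl | hx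
  · simp [hlt, ENNReal.tsum_const_eq_top_of_ne_zero hε0]
  have hex : ∃ n : ℕ, x ≤ (n + 1) * (ε : ℝ≥0∞) := by
    obtain ⟨n, hn⟩ := ENNReal.exists_nat_mul_gt hε0 hx
    exact ⟨n, hn.le.trans (by gcongr; simp)⟩
  classical
  calc x ≤ (Nat.find hex + 1) * (ε : ℝ≥0∞) := Nat.find_spec hex
    _ = ∑ k ∈ Finset.range (Nat.find hex),
          (if (k + 1) * (ε : ℝ≥0∞) < x then (ε : ℝ≥0∞) else 0) + ε := by
        rw [Finset.sum_congr rfl fun k hk => if_pos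
          (not_le.1 (Nat.find_min hex (Finset.mem_range.1 hk)))]
        simp [add_mul]
    _ ≤ _ := by
        gcongr
        exact ENNReal.sum_le_tsum _

end StaircaseApproximation

/-- Integration of a nonnegative lower semicontinuous function is lower semicontinuous for the
weak topology on probability measures. -/
lemma LowerSemicontinuous.lintegral_probabilityMeasure {X : Type*} [TopologicalSpace X]
    [MeasurableSpace X] [OpensMeasurableSpace X] [HasOuterApproxClosed X]
    {c : X → ℝ≥0∞} (hc : LowerSemicontinuous c) :
    LowerSemicontinuous fun μ : ProbabilityMeasure X => ∫⁻ x, c x ∂(μ : Measure X) := by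
  have hmeas (a : ℝ≥0∞) : MeasurableSet {x | a < c x} := (hc.isOpen_preimage a).measurableSet
  have hopen {U : Set X} (hU : IsOpen U) :
      LowerSemicontinuous fun μ : ProbabilityMeasure X => (μ : Measure X) U := fun μ =>
    lowerSemicontinuousAt_iff_le_liminf.2
      (ProbabilityMeasure.le_liminf_measure_open_of_tendsto tendsto_id hU)
  have hint (ε : ℝ≥0) (μ : ProbabilityMeasure X) :
      ∫⁻ x, ∑' k : ℕ, (if (k + 1) * (ε : ℝ≥0∞) < c x then (ε : ℝ≥0∞) else 0) ∂(μ : Measure X) =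
        ∑' k : ℕ, ε * (μ : Measure X) {x | (k + 1) * (ε : ℝ≥0∞) < c x} := by
    rw [lintegral_tsum fun k =>
      (Measurable.ite (hmeas _) measurable_const measurable_const).aemeasurable]
    refine tsum_congr fun k => ?_
    rw [← lintegral_indicator_const (hmeas _)]
    simp only [indicator_apply, mem_ofPred_eq]
  intro μ y hy
  obtain ⟨ε, hε, hyε⟩ := ENNReal.lt_iff_exists_add_pos_lt.1 hy
  have hlsc : LowerSemicontinuous fun μ : ProbabilityMeasure X =>
      ∑' k : ℕ, ε * (μ : Measure X) {x | (k + 1) * (ε : ℝ≥0∞) < c x} :=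
    lowerSemicontinuous_tsum fun k =>
      (ENNReal.continuous_const_mul ENNReal.coe_ne_top).comp_lowerSemicontinuous
        (hopen (hc.isOpen_preimage _)) fun a b hab => mul_le_mul_right hab _
  have hlt : y < ∑' k : ℕ, ε * (μ : Measure X) {x | (k + 1) * (ε : ℝ≥0∞) < c x} := by
    refine lt_of_add_lt_add_right (hyε.trans_le ?_)
    calc ∫⁻ x, c x ∂(μ : Measure X)
        ≤ ∫⁻ x, (∑' k : ℕ, (if (k + 1) * (ε : ℝ≥0∞) < c x then (ε : ℝ≥0∞) else 0) + ε)
            ∂(μ : Measure X) := lintegral_mono fun x => le_tsum_staircase_add hε _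
      _ = _ := by
        rw [lintegral_add_right _ measurable_const, hint]
        simp
  filter_upwards [hlsc μ y hlt] with μ' hμ'
  rw [← hint] at hμ'
  exact hμ'.trans_le (lintegral_mono fun x => tsum_staircase_le _ _)

section ConditionalExpectation

variable {α : Type*} {m m0 : MeasurableSpace α} {η : Measure α} [IsFiniteMeasure η]

lemma integral_condExp_mul (hm : m ≤ m0) {u v : α → ℝ} {K : ℝ}
    (hv : AEStronglyMeasurable v η) (hvK : ∀ x, ‖v x‖ ≤ K) :
    ∫ x, (η[u | m]) x * v x ∂η = ∫ x, (η[u | m]) x * (η[v | m]) x ∂η := by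
  have hv' : Integrable v η := .of_bound hv K (ae_of_all _ hvK)
  have huv : Integrable (η[u | m] * v) η := integrable_condExp.mul_bdd hv (ae_of_all _ hvK)
  calc ∫ x, (η[u | m]) x * v x ∂η = ∫ x, (η[η[u | m] * v | m]) x ∂η := (integral_condExp hm).symm
    _ = _ := integral_congr_ae (condExp_mul_of_stronglyMeasurable_left
      stronglyMeasurable_condExp huv hv')

/-- A bounded function is measurable for a sub-σ-field, up to modification on a null set, exactly
when it is orthogonal to all `1_A - E[1_A | m]`. -/
lemma ae_eq_condExp_iff_forall_integral_eq_zero (hm : m ≤ m0) {f : α → ℝ} {K : ℝ}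
    (hf : AEStronglyMeasurable f η) (hfK : ∀ x, ‖f x‖ ≤ K) :
    f =ᵐ[η] η[f | m] ↔ ∀ A, MeasurableSet A →
      ∫ x, (A.indicator 1 x - (η[A.indicator (1 : α → ℝ) | m]) x) * f x ∂η = 0 := by
  have hfi : Integrable f η := .of_bound hf K (ae_of_all _ hfK)
  have key {A : Set α} (hA : MeasurableSet A) :
      ∫ x, (A.indicator 1 x - (η[A.indicator (1 : α → ℝ) | m]) x) * f x ∂η =
        ∫ x in A, f x ∂η - ∫ x in A, (η[f | m]) x ∂η := by
    have h1 : Integrable (A.indicator (1 : α → ℝ)) η := (integrable_const 1).indicator hA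
    have hb (x : α) : ‖A.indicator (1 : α → ℝ) x‖ ≤ 1 := by
      by_cases h : x ∈ A <;> simp [h]
    have hmul (g : α → ℝ) : ∫ x in A, g x ∂η = ∫ x, A.indicator 1 x * g x ∂η := by
      rw [← integral_indicator hA]
      congr with x
      by_cases h : x ∈ A <;> simp [h]
    simp only [sub_mul]
    rw [integral_sub (h1.mul_bdd hf (ae_of_all _ hfK))
      (integrable_condExp.mul_bdd hf (ae_of_all _ hfK)), hmul, hmul,
      integral_condExp_mul hm hf hfK]
    simp only [mul_comm (A.indicator (1 : α → ℝ) _)]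
    rw [integral_condExp_mul hm h1.1 hb]
    simp only [mul_comm]
  constructor
  · intro h A hA
    rw [key hA, integral_congr_ae (ae_restrict_of_ae h), sub_self]
  · intro h
    refine ae_eq_of_forall_setIntegral_eq_of_sigmaFinite (fun _ _ _ => hfi.integrableOn)
      (fun _ _ _ => integrable_condExp.integrableOn) fun A hA _ => ?_
    rw [← sub_eq_zero, ← key hA, h A hA]

end ConditionalExpectation

section Augmentation

variable {α : Type*} {m : MeasurableSpace α} [mα : MeasurableSpace α] {η : Measure α}

lemma Measurable.congr_ae_aug {β : Type*} [MeasurableSpace β]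
    {f g : α → β} (hg : Measurable[aug η m] g) (hfg : f =ᵐ[η] g) : Measurable[aug η m] f := by
  have hnull {s : Set α} (hs : η s = 0) : MeasurableSet[aug η m] s :=
    le_sup_right (a := m) _ (MeasurableSpace.measurableSet_generateFrom hs)
  intro B hB
  have hN : η {x | f x ≠ g x} = 0 := hfg
  have hdecomp : f ⁻¹' B = (g ⁻¹' B \ {x | f x ≠ g x}) ∪ (f ⁻¹' B ∩ {x | f x ≠ g x}) := by
    ext x
    by_cases h : f x = g x <;> simp [h]
  rw [hdecomp]
  exact MeasurableSet.union (MeasurableSet.diff (hg hB) (hnull hN))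
    (hnull (measure_mono_null inter_subset_right hN))

/-- For a bounded Borel function, measurability for the augmentation of `m` can be tested by
orthogonality to the functions `1_A - E[1_A | m']`, with `m'` the Borel part of the augmentation. -/
lemma measurable_aug_iff_forall_integral_eq_zero [IsFiniteMeasure η]
    {f : α → ℝ} {K : ℝ} (hf : Measurable f) (hfK : ∀ x, ‖f x‖ ≤ K) :
    Measurable[aug η m] f ↔ ∀ A, MeasurableSet A →
      ∫ x, (A.indicator 1 x - (η[A.indicator (1 : α → ℝ) | aug η m ⊓ mα]) x) * f x ∂η = 0 := by
  rw [← ae_eq_condExp_iff_forall_integral_eq_zero inf_le_right hf.aestronglyMeasurable hfK]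
  constructor
  · intro h
    have h' : Measurable[aug η m ⊓ mα] f := fun B hB => ⟨h hB, hf hB⟩
    rw [condExp_of_stronglyMeasurable inf_le_right h'.stronglyMeasurable
      (.of_bound hf.aestronglyMeasurable K (ae_of_all _ hfK))]
  · intro h
    exact Measurable.congr_ae_aug
      (stronglyMeasurable_condExp.measurable.mono inf_le_left le_rfl) h

end Augmentation

section Disintegration

variable {E S : Type*} {m : MeasurableSpace E} [mE : MeasurableSpace E] [MeasurableSpace S]

/-- The transference plans with marginals `η` and `ν`. -/
def couplings (η : Measure E) (ν : Measure S) : Set (ProbabilityMeasure (E × S)) :=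
  {γ | (γ : Measure (E × S)).fst = η ∧ (γ : Measure (E × S)).snd = ν}

lemma IsCondKernel.compProd_eq {η : Measure E} [IsProbabilityMeasure η] {γ : Measure (E × S)}
    [IsFiniteMeasure γ] {Θ : Kernel E S} (hΘ : IsCondKernel η γ Θ) : η ⊗ₘ Θ = γ := by
  have := hΘ.1
  refine Measure.ext_prod fun hA hB => ?_
  rw [Measure.compProd_apply_prod hA hB, hΘ.2 _ _ hA hB]

/-- Measurability of a disintegration for the augmented σ-field, in terms of the plan itself. -/
lemma IsCondKernel.measurable_aug_iff {η : Measure E} [IsProbabilityMeasure η]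
    {γ : Measure (E × S)} [IsFiniteMeasure γ] {Θ : Kernel E S} (hΘ : IsCondKernel η γ Θ)
    {C : Set S} (hC : MeasurableSet C) :
    Measurable[aug η m] (fun ω => Θ ω C) ↔ ∀ A, MeasurableSet A →
      ∫ p, (A.indicator 1 p.1 - (η[A.indicator (1 : E → ℝ) | aug η m ⊓ mE]) p.1) *
        C.indicator 1 p.2 ∂γ = 0 := by
  have := hΘ.1
  have hreal : Measurable[aug η m] (fun ω => Θ ω C) ↔ Measurable[aug η m] fun ω => (Θ ω).real C :=
    ⟨fun h => h.ennreal_toReal, fun h => by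
      simpa [Measure.real] using h.ennreal_ofReal⟩
  have hmeas : Measurable fun ω => (Θ ω).real C := (Θ.measurable_coe hC).ennreal_toReal
  rw [hreal, measurable_aug_iff_forall_integral_eq_zero (K := 1)
    hmeas fun ω => by simp [abs_of_nonneg]]
  refine forall₂_congr fun A hA => ?_
  rw [← hΘ.compProd_eq, Measure.integral_compProd]
  · simp [integral_const_mul, integral_indicator_one hC]
  · refine Integrable.mul_bdd (c := 1) ?_ ?_ (ae_of_all _ fun p => ?_)
    · have hfst : MeasurePreserving Prod.fst (η ⊗ₘ Θ) η := ⟨measurable_fst, Measure.fst_compProd _ _⟩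
      exact hfst.integrable_comp_of_integrable
        (((integrable_const (1 : ℝ)).indicator hA).sub integrable_condExp)
    · exact ((measurable_const.indicator hC).comp measurable_snd).aestronglyMeasurable
    · by_cases h : p.2 ∈ C <;> simp [h]

lemma causalPlan_prod (ℱE : unitInterval → MeasurableSpace E)
    (ℱS : unitInterval → MeasurableSpace S) (η : Measure E) [IsProbabilityMeasure η]
    (ν : Measure S) [IsProbabilityMeasure ν] : CausalPlan ℱE ℱS η (η.prod ν) := by
  refine ⟨Measure.fst_prod, Kernel.const E ν, ⟨inferInstance, fun A B _ _ => ?_⟩,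
    fun t C _ => by simp⟩
  simp [mul_comm]

/-- Causality of a coupling is a family of linear constraints on the plan. -/
lemma causalPlan_iff_of_mem_couplings [StandardBorelSpace S]
    {ℱE : unitInterval → MeasurableSpace E}
    {ℱS : unitInterval → MeasurableSpace S} (hleS : ∀ t, ℱS t ≤ ‹MeasurableSpace S›)
    {η : Measure E} [IsProbabilityMeasure η] {ν : Measure S}
    {γ : ProbabilityMeasure (E × S)} (hγ : γ ∈ couplings η ν) :
    CausalPlan ℱE ℱS η (γ : Measure (E × S)) ↔
      ∀ t C, MeasurableSet[ℱS t] C → ∀ A, MeasurableSet A →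
        ∫ p, (A.indicator 1 p.1 - (η[A.indicator (1 : E → ℝ) | aug η (ℱE t) ⊓ ‹_›]) p.1) *
          C.indicator 1 p.2 ∂(γ : Measure (E × S)) = 0 := by
  constructor
  · rintro ⟨-, Θ, hΘ, hcausal⟩ t C hC
    exact (hΘ.measurable_aug_iff (hleS t C hC)).1 (hcausal t C hC)
  · intro h
    have : Nonempty S := ((γ : Measure (E × S)).nonempty_of_neZero).map Prod.snd
    have hΘ : IsCondKernel η (γ : Measure (E × S)) (γ : Measure (E × S)).condKernel := by
      refine ⟨inferInstance, fun A B hA hB => ?_⟩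
      rw [← Measure.compProd_apply_prod hA hB, ← hγ.1, Measure.disintegrate]
    exact ⟨hγ.1, _, hΘ, fun t C hC =>
      (hΘ.measurable_aug_iff (hleS t C hC)).2 (h t C hC)⟩

end Disintegration

section Couplings

variable {E S : Type*} [MeasurableSpace E] [TopologicalSpace E] [PolishSpace E] [BorelSpace E]
  [MeasurableSpace S] [TopologicalSpace S] [PolishSpace S] [BorelSpace S]

lemma isClosed_couplings (η : Measure E) [IsProbabilityMeasure η] (ν : Measure S)
    [IsProbabilityMeasure ν] : IsClosed (couplings η ν) := by
  have h1 : IsClosed {γ : ProbabilityMeasure (E × S) | (γ : Measure (E × S)).fst = η} := by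
    convert! isClosed_eq (ProbabilityMeasure.continuous_map (continuous_fst (X := E) (Y := S)))
      (continuous_const (y := (⟨η, inferInstance⟩ : ProbabilityMeasure E))) using 2
    ext γ
    exact (Subtype.ext_iff (a1 := γ.map measurable_fst.aemeasurable)
      (a2 := (⟨η, inferInstance⟩ : ProbabilityMeasure E))).symm
  have h2 : IsClosed {γ : ProbabilityMeasure (E × S) | (γ : Measure (E × S)).snd = ν} := by
    convert! isClosed_eq (ProbabilityMeasure.continuous_map (continuous_snd (X := E) (Y := S)))
      (continuous_const (y := (⟨ν, inferInstance⟩ : ProbabilityMeasure S))) using 2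
    ext γ
    exact (Subtype.ext_iff (a1 := γ.map measurable_snd.aemeasurable)
      (a2 := (⟨ν, inferInstance⟩ : ProbabilityMeasure S))).symm
  exact h1.inter h2

lemma isCompact_couplings (η : Measure E) [IsProbabilityMeasure η] (ν : Measure S)
    [IsProbabilityMeasure ν] : IsCompact (couplings η ν) := by
  rw [← (isClosed_couplings η ν).closure_eq]
  refine isCompact_closure_of_isTightMeasureSet ?_
  rw [isTightMeasureSet_iff_exists_isCompact_measure_compl_le]
  intro ε hε
  have hε2 : 0 < ε / 2 := ENNReal.half_pos hε.ne'
  obtain ⟨K, hK, hKε⟩ := isTightMeasureSet_iff_exists_isCompact_measure_compl_le.1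
    (isTightMeasureSet_singleton (μ := η)) _ hε2
  obtain ⟨L, hL, hLε⟩ := isTightMeasureSet_iff_exists_isCompact_measure_compl_le.1
    (isTightMeasureSet_singleton (μ := ν)) _ hε2
  refine ⟨K ×ˢ L, hK.prod hL, ?_⟩
  rintro _ ⟨γ, ⟨rfl, rfl⟩, rfl⟩
  calc (γ : Measure (E × S)) (K ×ˢ L)ᶜ
      ≤ (γ : Measure (E × S)) (Prod.fst ⁻¹' Kᶜ ∪ Prod.snd ⁻¹' Lᶜ) :=
        measure_mono fun p hp => by
          by_contra h
          simp_all
    _ ≤ (γ : Measure (E × S)) (Prod.fst ⁻¹' Kᶜ) + (γ : Measure (E × S)) (Prod.snd ⁻¹' Lᶜ) :=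
        measure_union_le _ _
    _ ≤ ε / 2 + ε / 2 := by
        rw [← Measure.fst_apply hK.measurableSet.compl, ← Measure.snd_apply hL.measurableSet.compl]
        exact add_le_add (hKε _ rfl) (hLε _ rfl)
    _ = ε := ENNReal.add_halves ε

/-- On the couplings of two fixed marginals, weak convergence implies convergence of the integrals
of tensor products of measurable functions, without any continuity assumption. -/
lemma continuousOn_integral_mul_couplings {η : Measure E} [IsProbabilityMeasure η] {ν : Measure S}
    [IsProbabilityMeasure ν] {h : E → ℝ} {g : S → ℝ} {K : ℝ} (hh : Integrable h η)
    (hg : AEStronglyMeasurable g ν) (hgK : ∀ y, ‖g y‖ ≤ K) :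
    ContinuousOn (fun γ : ProbabilityMeasure (E × S) => ∫ p, h p.1 * g p.2 ∂(γ : Measure (E × S)))
      (couplings η ν) := by
  have hgi : Integrable g ν := .of_bound hg K (ae_of_all _ hgK)
  refine continuousOn_of_uniform_approx_of_continuousOn fun u hu => ?_
  obtain ⟨ε, hε, hεu⟩ := Metric.mem_uniformity_dist.1 hu
  obtain ⟨δ, hδ, hδε⟩ : ∃ δ > 0, δ * |K| + δ < ε := by
    refine ⟨ε / (|K| + 2), by positivity, ?_⟩
    rw [← mul_add_one, div_mul_eq_mul_div, div_lt_iff₀ (by positivity)]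
    gcongr
    norm_num
  obtain ⟨h', hh', -⟩ := hh.exists_boundedContinuous_integral_sub_le hδ
  obtain ⟨g', hg', -⟩ := hgi.exists_boundedContinuous_integral_sub_le
    (ε := δ / (‖h'‖ + 1)) (by positivity)
  have hcont := ProbabilityMeasure.continuous_integral_boundedContinuousFunction
    (h'.compContinuous ⟨Prod.fst, continuous_fst⟩ * g'.compContinuous ⟨Prod.snd, continuous_snd⟩ :
      BoundedContinuousFunction (E × S) ℝ)
  refine ⟨_, hcont.continuousOn, ?_⟩
  rintro γ ⟨hγη, hγν⟩
  refine hεu ?_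
  have hfst : MeasurePreserving Prod.fst (γ : Measure (E × S)) η := ⟨measurable_fst, hγη⟩
  have hsnd : MeasurePreserving Prod.snd (γ : Measure (E × S)) ν := ⟨measurable_snd, hγν⟩
  have hh'i : Integrable h' η := h'.integrable η
  have hg'i : Integrable g' ν := g'.integrable ν
  have i1 : Integrable (fun p : E × S => h p.1 * g p.2) (γ : Measure (E × S)) :=
    (hfst.integrable_comp_of_integrable hh).mul_bdd (hg.comp_measurePreserving hsnd)
      (ae_of_all _ fun p => hgK p.2)
  have i2 : Integrable (fun p : E × S => h' p.1 * g' p.2) (γ : Measure (E × S)) :=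
    (hfst.integrable_comp_of_integrable hh'i).mul_bdd
      (g'.continuous.comp continuous_snd).aestronglyMeasurable
      (ae_of_all _ fun p => g'.norm_coe_le_norm p.2)
  have j1 : Integrable (fun p : E × S => ‖h p.1 - h' p.1‖) (γ : Measure (E × S)) :=
    hfst.integrable_comp_of_integrable (hh.sub hh'i).norm
  have j2 : Integrable (fun p : E × S => ‖g p.2 - g' p.2‖) (γ : Measure (E × S)) :=
    hsnd.integrable_comp_of_integrable (hgi.sub hg'i).norm
  have e1 : ∫ p, ‖h p.1 - h' p.1‖ ∂(γ : Measure (E × S)) = ∫ x, ‖h x - h' x‖ ∂η := by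
    rw [← hγη, Measure.fst, integral_map measurable_fst.aemeasurable]
    rw [← Measure.fst, hγη]
    exact (hh.sub hh'i).norm.aestronglyMeasurable
  have e2 : ∫ p, ‖g p.2 - g' p.2‖ ∂(γ : Measure (E × S)) = ∫ y, ‖g y - g' y‖ ∂ν := by
    rw [← hγν, Measure.snd, integral_map measurable_snd.aemeasurable]
    rw [← Measure.snd, hγν]
    exact (hgi.sub hg'i).norm.aestronglyMeasurable
  change dist (∫ p, h p.1 * g p.2 ∂(γ : Measure (E × S)))
    (∫ p, h' p.1 * g' p.2 ∂(γ : Measure (E × S))) < ε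
  rw [dist_eq_norm, ← integral_sub i1 i2]
  calc ‖∫ p, (h p.1 * g p.2 - h' p.1 * g' p.2) ∂(γ : Measure (E × S))‖
      ≤ ∫ p, (‖h p.1 - h' p.1‖ * |K| + ‖h'‖ * ‖g p.2 - g' p.2‖) ∂(γ : Measure (E × S)) := by
        refine norm_integral_le_of_norm_le ((j1.mul_const _).add (j2.const_mul _))
          (ae_of_all _ fun p => ?_)
        have : h p.1 * g p.2 - h' p.1 * g' p.2 =
          (h p.1 - h' p.1) * g p.2 + h' p.1 * (g p.2 - g' p.2) := by ring
        rw [this]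
        refine (norm_add_le _ _).trans ?_
        rw [norm_mul, norm_mul]
        gcongr
        · exact (hgK p.2).trans (le_abs_self K)
        · exact h'.norm_coe_le_norm p.1
    _ = (∫ x, ‖h x - h' x‖ ∂η) * |K| + ‖h'‖ * ∫ y, ‖g y - g' y‖ ∂ν := by
        rw [integral_add (j1.mul_const _) (j2.const_mul _), integral_mul_const,
          integral_const_mul, e1, e2]
    _ ≤ δ * |K| + ‖h'‖ * (δ / (‖h'‖ + 1)) := by gcongr
    _ ≤ δ * |K| + δ := by
        gcongr
        rw [mul_div_assoc', div_le_iff₀ (by positivity), mul_comm]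
        gcongr
        simp
    _ < ε := hδε

lemma isCompact_causal_couplings (ℱE : unitInterval → MeasurableSpace E)
    {ℱS : unitInterval → MeasurableSpace S} (hleS : ∀ t, ℱS t ≤ ‹MeasurableSpace S›)
    (η : Measure E) [IsProbabilityMeasure η] (ν : Measure S) [IsProbabilityMeasure ν] :
    IsCompact {γ ∈ couplings η ν | CausalPlan ℱE ℱS η (γ : Measure (E × S))} := by
  refine (isCompact_couplings η ν).of_isClosed_subset ?_ (sep_subset _ _)
  have hset : {γ ∈ couplings η ν | CausalPlan ℱE ℱS η (γ : Measure (E × S))} =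
      couplings η ν ∩ ⋂ (t) (C) (_ : MeasurableSet[ℱS t] C) (A) (_ : MeasurableSet A),
        couplings η ν ∩ (fun γ : ProbabilityMeasure (E × S) => ∫ p, (A.indicator 1 p.1 -
          (η[A.indicator (1 : E → ℝ) | aug η (ℱE t) ⊓ ‹_›]) p.1) *
            C.indicator 1 p.2 ∂(γ : Measure (E × S))) ⁻¹' {0} := by
    ext γ
    simp only [mem_sep_iff, mem_inter_iff, mem_iInter, mem_preimage, mem_singleton_iff]
    refine and_congr_right fun hγ => ?_
    simp only [causalPlan_iff_of_mem_couplings hleS hγ, hγ, true_and]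
  rw [hset]
  refine (isClosed_couplings η ν).inter <| isClosed_iInter fun t => isClosed_iInter fun C =>
    isClosed_iInter fun hC => isClosed_iInter fun A => isClosed_iInter fun hA =>
      ContinuousOn.preimage_isClosed_of_isClosed ?_ (isClosed_couplings η ν) isClosed_singleton
  refine continuousOn_integral_mul_couplings (K := 1)
    (((integrable_const (1 : ℝ)).indicator hA).sub integrable_condExp)
    (measurable_const.indicator (hleS t C hC)).aestronglyMeasurable fun y => ?_
  by_cases h : y ∈ C <;> simp [h]

end Couplings

/-- for a nonnegative lower semicontinuous cost `c`, the causal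
Monge–Kantorovich problem over `Π_c(η,ν)` admits a minimizer. -/
theorem exists_optimal_causal_plan
    {E S : Type*} [MeasurableSpace E] [TopologicalSpace E] [PolishSpace E] [BorelSpace E]
    [MeasurableSpace S] [TopologicalSpace S] [PolishSpace S] [BorelSpace S]
    (ℱE : unitInterval → MeasurableSpace E) (ℱS : unitInterval → MeasurableSpace S)
    (hmonoE : Monotone ℱE) (hleE : ∀ t, ℱE t ≤ ‹MeasurableSpace E›)
    (hmonoS : Monotone ℱS) (hleS : ∀ t, ℱS t ≤ ‹MeasurableSpace S›)
    (η : Measure E) [IsProbabilityMeasure η] (ν : Measure S) [IsProbabilityMeasure ν]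
    (c : E × S → ℝ≥0∞) (hc : LowerSemicontinuous c) :
    ∃ γstar : ProbabilityMeasure (E × S),
      (CausalPlan ℱE ℱS η (γstar : Measure (E × S)) ∧ (γstar : Measure (E × S)).snd = ν) ∧
      ∀ γ : ProbabilityMeasure (E × S),
        CausalPlan ℱE ℱS η (γ : Measure (E × S)) → (γ : Measure (E × S)).snd = ν →
        ∫⁻ p, c p ∂(γstar : Measure (E × S)) ≤ ∫⁻ p, c p ∂(γ : Measure (E × S)) := by
  obtain ⟨γstar, ⟨hmarg, hcausal⟩, hmin⟩ := LowerSemicontinuousOn.exists_isMinOn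
    (s := {γ ∈ couplings η ν | CausalPlan ℱE ℱS η (γ : Measure (E × S))})
    ⟨⟨η.prod ν, inferInstance⟩, ⟨Measure.fst_prod, Measure.snd_prod⟩, causalPlan_prod ℱE ℱS η ν⟩
    (isCompact_causal_couplings ℱE hleS η ν)
    (hc.lintegral_probabilityMeasure.lowerSemicontinuousOn _)
  exact ⟨γstar, ⟨hcausal, hmarg.2⟩, fun γ hγ hγν => hmin ⟨⟨hγ.1, hγν⟩, hγ⟩⟩
end
end

section
/- Let W = C([0,1], ℝ^d) with the filtration generated by the coordinate process, and let (Ω, A, P) be a complete probability space with measurable maps Y : Ω → W and X : Ω → S (S a filtered Polish space), such that t ↦ Y_t is a Brownian motion with respect to its own filtration. Then (Y,X) is a causal coupling (i.e., (Y×X)_*P ∈ Π_c(Y_*P, X_*P)) if and only if t ↦ Y_t is a Brownian motion with respect to the filtration σ(G_t^X ∪ G_t^Y). -/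
open MeasureTheory ProbabilityTheory Filter Set Topology
open scoped ENNReal NNReal

noncomputable section

/-- The classical Wiener path space `W = C([0,1], ℝ^d)`. -/
abbrev WW (d : ℕ) := C(unitInterval, EuclideanSpace ℝ (Fin d))

instance (d : ℕ) : MeasurableSpace (WW d) := borel _
instance (d : ℕ) : BorelSpace (WW d) := ⟨rfl⟩

/-- The filtration generated by the coordinate process on `W`. -/
def coordF (d : ℕ) (t : unitInterval) : MeasurableSpace (WW d) :=
  ⨆ (s : unitInterval) (_ : s ≤ t),
    MeasurableSpace.comap (fun ω : WW d => ω s) inferInstance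

/-- `Y : Ω → W` is a `d`-dimensional Brownian motion with respect to the filtration `𝒜`
under `P`: it is `𝒜`-adapted, starts at `0`, and has increments which are Gaussian with
variance `t - s` and independent of `𝒜 s`. -/
def IsBMWrt {d : ℕ} {Ω : Type*} [MeasurableSpace Ω]
    (𝒜 : unitInterval → MeasurableSpace Ω) (Y : Ω → WW d) (P : Measure Ω) : Prop :=
  (∀ t : unitInterval, Measurable[𝒜 t] (fun ω => Y ω t)) ∧
  (∀ᵐ ω ∂P, Y ω 0 = 0) ∧
  (∀ s t : unitInterval, s ≤ t →
    (∀ i : Fin d,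
      P.map (fun ω => Y ω t i - Y ω s i) = gaussianReal 0 (Real.toNNReal ((t : ℝ) - s))) ∧
    Indep (MeasurableSpace.comap (fun ω => Y ω t - Y ω s) inferInstance) (𝒜 s) P)

/-- `μ` is the Wiener measure on `W`. -/
def IsWienerMeasure {d : ℕ} (μ : Measure (WW d)) : Prop :=
  IsProbabilityMeasure μ ∧ IsBMWrt (coordF d) (fun ω => ω) μ

/-- The augmentation consists of the sets that agree a.e. with a set of the original σ-field. -/
theorem aug_eq_eventuallyMeasurableSpace {α : Type*} (m : MeasurableSpace α)
    [MeasurableSpace α] (η : Measure α) : aug η m = eventuallyMeasurableSpace m (ae η) := by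
  apply le_antisymm
  · refine sup_le le_eventuallyMeasurableSpace (MeasurableSpace.generateFrom_le fun s hs => ?_)
    exact ⟨∅, @MeasurableSet.empty _ m, ae_eq_empty.2 hs⟩
  · rintro s ⟨t, ht, hst⟩
    have hnull : ∀ N : Set α, η N = 0 → MeasurableSet[aug η m] N := fun N hN =>
      (le_sup_right : _ ≤ aug η m) _ (MeasurableSpace.measurableSet_generateFrom hN)
    have h := (((le_sup_left : m ≤ aug η m) t ht).diff
      (hnull _ (ae_eq_set.1 hst).2)).union (hnull _ (ae_eq_set.1 hst).1)
    have hs : s = t \ (t \ s) ∪ s \ t := by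
      ext x
      simp only [mem_union, Set.mem_sdiff]
      tauto
    rwa [hs]

theorem aug_mono {α : Type*} {m₁ m₂ : MeasurableSpace α} [MeasurableSpace α] (η : Measure α)
    (h : m₁ ≤ m₂) : aug η m₁ ≤ aug η m₂ :=
  sup_le_sup_right h _

/-- Independence is insensitive to augmentation by null sets. -/
theorem indep_aug_right {Ω : Type*} {m₁ m₂ mΩ : MeasurableSpace Ω}
    {P : Measure Ω} (h : Indep m₁ m₂ P) : Indep m₁ (aug P m₂) P := by
  rw [aug_eq_eventuallyMeasurableSpace, Indep_iff]
  rintro s t hs ⟨t', ht', htt'⟩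
  rw [measure_congr ((ae_eq_refl s).inter htt'), measure_congr htt']
  exact (Indep_iff _ _ _).1 h s t' hs ht'

theorem isPiSystem_image2_inter {Ω : Type*} (m₁ m₂ : MeasurableSpace Ω) :
    IsPiSystem (image2 (· ∩ ·) {s | MeasurableSet[m₁] s} {s | MeasurableSet[m₂] s}) := by
  rintro _ ⟨a, ha, b, hb, rfl⟩ _ ⟨a', ha', b', hb', rfl⟩ -
  exact ⟨a ∩ a', ha.inter ha', b ∩ b', hb.inter hb', inter_inter_inter_comm _ _ _ _⟩

theorem sup_eq_generateFrom_image2_inter {Ω : Type*} (m₁ m₂ : MeasurableSpace Ω) :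
    m₁ ⊔ m₂ = MeasurableSpace.generateFrom
      (image2 (· ∩ ·) {s | MeasurableSet[m₁] s} {s | MeasurableSet[m₂] s}) := by
  apply le_antisymm
  · refine sup_le (fun s hs => ?_) (fun s hs => ?_)
    · exact MeasurableSpace.measurableSet_generateFrom ⟨s, hs, univ, MeasurableSet.univ, by simp⟩
    · exact MeasurableSpace.measurableSet_generateFrom ⟨univ, MeasurableSet.univ, s, hs, by simp⟩
  · refine MeasurableSpace.generateFrom_le ?_
    rintro _ ⟨a, ha, b, hb, rfl⟩
    exact ((le_sup_left : m₁ ≤ m₁ ⊔ m₂) a ha).inter ((le_sup_right : m₂ ≤ m₁ ⊔ m₂) b hb)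

/-- Independence from a join may be tested on intersections. -/
theorem indep_sup_right_of_inter {Ω : Type*} {m m₁ m₂ mΩ : MeasurableSpace Ω} {P : Measure Ω}
    [IsProbabilityMeasure P] (hm : m ≤ mΩ) (h₁ : m₁ ≤ mΩ)
    (h₂ : m₂ ≤ mΩ)
    (h : ∀ s a b, MeasurableSet[m] s → MeasurableSet[m₁] a → MeasurableSet[m₂] b →
      P (s ∩ (a ∩ b)) = P s * P (a ∩ b)) :
    Indep m (m₁ ⊔ m₂) P := by
  refine IndepSets.indep hm (sup_le h₁ h₂) (@MeasurableSpace.isPiSystem_measurableSet _ m)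
    (isPiSystem_image2_inter m₁ m₂) (@MeasurableSpace.generateFrom_measurableSet _ m).symm
    (sup_eq_generateFrom_image2_inter m₁ m₂) ?_
  rw [IndepSets_iff]
  rintro s _ hs ⟨a, ha, b, hb, rfl⟩
  exact h s a b hs ha hb

/-- If every increment of an adapted process is independent of the past, then so is the whole
family of future increments. -/
theorem indep_iSup_increments {Ω ι E : Type*} {mΩ : MeasurableSpace Ω} {P : Measure Ω}
    [IsProbabilityMeasure P] [LinearOrder ι] [AddCommGroup E] [MeasurableSpace E]
    [MeasurableAdd₂ E] [MeasurableSub₂ E] {𝒜 : ι → MeasurableSpace Ω} (hmono : Monotone 𝒜)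
    (hle : ∀ t, 𝒜 t ≤ mΩ) {Z : ι → Ω → E} (hZ : ∀ t, Measurable[𝒜 t] (Z t))
    (hind : ∀ s t, s ≤ t →
      Indep (MeasurableSpace.comap (fun ω => Z t ω - Z s ω) inferInstance) (𝒜 s) P) (t : ι) :
    Indep (⨆ (s : ι) (_ : t ≤ s), MeasurableSpace.comap (fun ω => Z s ω - Z t ω) inferInstance)
      (𝒜 t) P := by
  classical
  have hinc : ∀ {r s u}, r ≤ u → s ≤ u → Measurable[𝒜 u] (fun ω => Z s ω - Z r ω) :=
    fun hr hs => ((hZ _).mono (hmono hs) le_rfl).sub ((hZ _).mono (hmono hr) le_rfl)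
  set G : Finset ι → MeasurableSpace Ω := fun T =>
    ⨆ s ∈ T, MeasurableSpace.comap (fun ω => Z s ω - Z t ω) inferInstance with hG
  have hGmono : Monotone G := fun T T' h => biSup_mono h
  have hGle : ∀ (T : Finset ι) u, t ≤ u → (∀ s ∈ T, s ≤ u) → G T ≤ 𝒜 u := fun T u htu hT =>
    iSup₂_le fun s hs => (hinc htu (hT s hs)).comap_le
  have hGmΩ : ∀ T : Finset ι, G T ≤ mΩ := fun T => iSup₂_le fun s _ =>
    (((hZ s).mono (hle s) le_rfl).sub ((hZ t).mono (hle t) le_rfl)).comap_le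
  have key : ∀ T : Finset ι, (∀ s ∈ T, t ≤ s) → Indep (G T) (𝒜 t) P := by
    intro T
    induction T using Finset.induction_on_max with
    | empty => intro _; simpa [hG] using indep_bot_left (𝒜 t)
    | insert a T hmax ih =>
      intro hT
      have hta : t ≤ a := hT a (Finset.mem_insert_self a T)
      have ih' := ih fun s hs => hT s (Finset.mem_insert_of_mem hs)
      obtain ⟨b, htb, hba, hTb, hb⟩ : ∃ b, t ≤ b ∧ b ≤ a ∧ (∀ s ∈ T, s ≤ b) ∧
          Measurable[G T] (fun ω => Z b ω - Z t ω) := by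
        rcases T.eq_empty_or_nonempty with rfl | hne
        · exact ⟨t, le_rfl, hta, by simp, by simp⟩
        · refine ⟨T.max' hne, hT _ (Finset.mem_insert_of_mem (T.max'_mem hne)),
            (hmax _ (T.max'_mem hne)).le, fun s hs => T.le_max' s hs, ?_⟩
          exact (comap_measurable _).mono (le_iSup₂_of_le (T.max' hne) (T.max'_mem hne) le_rfl)
            le_rfl
      have hstep : Indep (𝒜 t)
          (G T ⊔ MeasurableSpace.comap (fun ω => Z a ω - Z b ω) inferInstance) P := by
        refine indep_sup_right_of_inter (hle t) (hGmΩ T)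
          ((hinc hba le_rfl).comap_le.trans (hle a)) fun s g d hs hg hd => ?_
        have hg' := hGle T b htb hTb g hg
        have hD := (Indep_iff _ _ _).1 (hind b a hba)
        rw [← inter_assoc, inter_comm _ d, inter_comm g d,
          hD d _ hd ((hmono htb s hs).inter hg'), hD d _ hd hg', inter_comm s g,
          (Indep_iff _ _ _).1 ih' g s hg hs]
        ring
      refine indep_of_indep_of_le_left hstep.symm (iSup₂_le fun s hs => ?_)
      rcases Finset.mem_insert.1 hs with rfl | hs
      · have h := (hb.mono (le_sup_left : G T ≤ G T ⊔ MeasurableSpace.comap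
          (fun ω => Z s ω - Z b ω) inferInstance) le_rfl).add
          ((comap_measurable (fun ω => Z s ω - Z b ω)).mono le_sup_right le_rfl)
        refine Measurable.comap_le ?_
        convert h using 2
        simp
      · exact (le_iSup₂_of_le s hs le_rfl : _ ≤ G T).trans le_sup_left
  have hfin : Indep (⨆ T : {T : Finset ι // ∀ s ∈ T, t ≤ s}, G T) (𝒜 t) P := by
    refine indep_iSup_of_directed_le (fun T => key T T.2) (fun T => hGmΩ T) (hle t) ?_
    intro T T'
    refine ⟨⟨T.1 ∪ T'.1, fun s hs => ?_⟩, hGmono Finset.subset_union_left,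
      hGmono Finset.subset_union_right⟩
    exact (Finset.mem_union.1 hs).elim (T.2 s) (T'.2 s)
  refine indep_of_indep_of_le_left hfin (iSup₂_le fun s hs => ?_)
  refine le_iSup_of_le (⟨{s}, by simpa using hs⟩ : {T : Finset ι // ∀ s ∈ T, t ≤ s}) ?_
  simp [hG]

/-- The Borel σ-field of the path space is generated by the coordinates. -/
theorem borel_le_iSup_comap_eval (d : ℕ) :
    (inferInstance : MeasurableSpace (WW d)) ≤
      ⨆ s : unitInterval, MeasurableSpace.comap (fun ω : WW d => ω s) inferInstance := by
  let F : WW d → ℕ → EuclideanSpace ℝ (Fin d) := fun ω n =>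
    ω (TopologicalSpace.denseSeq unitInterval n)
  have hFc : Continuous F := by fun_prop
  have hFi : Function.Injective F := fun f g h => by
    refine DFunLike.coe_injective ?_
    exact Continuous.ext_on (TopologicalSpace.denseRange_denseSeq unitInterval) f.continuous
      g.continuous (by rintro _ ⟨n, rfl⟩; exact congrFun h n)
  rw [← (hFc.measurableEmbedding hFi).comap_eq, MeasurableSpace.pi, MeasurableSpace.comap_iSup]
  refine iSup_le fun n => ?_
  rw [MeasurableSpace.comap_comp]
  exact le_iSup_of_le (TopologicalSpace.denseSeq unitInterval n) le_rfl

theorem coordF_le (d : ℕ) (t : unitInterval) : coordF d t ≤ borel (WW d) :=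
  iSup₂_le fun s _ => (by fun_prop : Continuous fun ω : WW d => ω s).measurable.comap_le

theorem coordF_mono (d : ℕ) : Monotone (coordF d) := fun _ _ h =>
  iSup₂_le fun s hs => le_iSup₂_of_le s (hs.trans h) le_rfl

theorem measurable_coordF_eval {d : ℕ} {s t : unitInterval} (h : s ≤ t) :
    Measurable[coordF d t] fun ω : WW d => ω s :=
  (comap_measurable _).mono (le_iSup₂_of_le s h le_rfl) le_rfl

/-- The σ-field generated by the increments of the coordinate process after time `t`. -/
def incrF (d : ℕ) (t : unitInterval) : MeasurableSpace (WW d) :=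
  ⨆ (s : unitInterval) (_ : t ≤ s),
    MeasurableSpace.comap (fun ω : WW d => ω s - ω t) inferInstance

theorem incrF_le (d : ℕ) (t : unitInterval) : incrF d t ≤ borel (WW d) :=
  iSup₂_le fun s _ => (by fun_prop : Continuous fun ω : WW d => ω s - ω t).measurable.comap_le

theorem coordF_sup_incrF (d : ℕ) (t : unitInterval) :
    borel (WW d) = coordF d t ⊔ incrF d t := by
  refine le_antisymm ((borel_le_iSup_comap_eval d).trans (iSup_le fun s => ?_))
    (sup_le (coordF_le d t) (incrF_le d t))
  refine Measurable.comap_le ?_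
  rcases le_total s t with h | h
  · exact (measurable_coordF_eval h).mono le_sup_left le_rfl
  · have h₁ : Measurable[coordF d t ⊔ incrF d t] fun ω : WW d => ω s - ω t :=
      (comap_measurable _).mono
        ((le_iSup₂_of_le s h le_rfl : _ ≤ incrF d t).trans le_sup_right) le_rfl
    have h₂ : Measurable[coordF d t ⊔ incrF d t] fun ω : WW d => ω t :=
      (measurable_coordF_eval le_rfl).mono le_sup_left le_rfl
    convert h₁.add h₂ using 1
    ext1 ω
    simp

theorem setLIntegral_inter_of_indep {α : Type*} {m m' mα : MeasurableSpace α} {η : Measure α}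
    (hm : m ≤ mα) (hm' : m' ≤ mα) (hind : Indep m m' η) {g : α → ℝ≥0∞} (hg : Measurable[m] g)
    {a b : Set α} (ha : MeasurableSet[m] a) (hb : MeasurableSet[m'] b) :
    ∫⁻ x in a ∩ b, g x ∂η = (∫⁻ x in a, g x ∂η) * η b := by
  have hone : Measurable[m'] (b.indicator (1 : α → ℝ≥0∞)) :=
    Measurable.indicator (@measurable_const _ _ _ m' (1 : ℝ≥0∞)) hb
  have h := lintegral_mul_eq_lintegral_mul_lintegral_of_independent_measurableSpace hm hm' hind
    (hg.indicator ha) hone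
  rw [lintegral_indicator (hm a ha), lintegral_indicator_one (hm' b hb)] at h
  rw [← h, ← lintegral_indicator ((hm a ha).inter (hm' b hb))]
  congr with x
  by_cases hxa : x ∈ a <;> by_cases hxb : x ∈ b <;> simp [hxa, hxb]

theorem setLIntegral_inter_of_indep_aug {α : Type*} {m m' mα : MeasurableSpace α}
    {η : Measure α} (hm : m ≤ mα) (hm' : m' ≤ mα) (hind : Indep (aug η m) m' η) {g : α → ℝ≥0∞}
    (hg : Measurable g) (hg_aug : Measurable[aug η m] g) {a b : Set α} (ha : MeasurableSet[m] a)
    (hb : MeasurableSet[m'] b) :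
    ∫⁻ x in a ∩ b, g x ∂η = (∫⁻ x in a, g x ∂η) * η b :=
  setLIntegral_inter_of_indep (m := m ⊔ MeasurableSpace.comap g inferInstance)
    (sup_le hm hg.comap_le) hm'
    (indep_of_indep_of_le_left hind (sup_le le_sup_left hg_aug.comap_le))
    ((comap_measurable g).mono le_sup_right le_rfl)
    ((le_sup_left : m ≤ m ⊔ MeasurableSpace.comap g inferInstance) a ha) hb

theorem indep_map_of_indep_comap {Ω α : Type*} {m₁ m₂ mα : MeasurableSpace α}
    {mΩ : MeasurableSpace Ω} {P : Measure Ω} {Y : Ω → α} (hY : Measurable Y) (h₁ : m₁ ≤ mα)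
    (h₂ : m₂ ≤ mα) (h : Indep (m₁.comap Y) (m₂.comap Y) P) : Indep m₁ m₂ (P.map Y) := by
  rw [Indep_iff] at h ⊢
  intro a b ha hb
  rw [Measure.map_apply hY ((h₁ a ha).inter (h₂ b hb)), Measure.map_apply hY (h₁ a ha),
    Measure.map_apply hY (h₂ b hb)]
  exact h _ _ ⟨a, ha, rfl⟩ ⟨b, hb, rfl⟩

/-- If `m` and `m'` are independent and generate the σ-field, and `ν` factorises over them,
then the density of `ν` is measurable for the augmentation of `m`. -/
theorem measurable_aug_of_factorisation {α : Type*} {m m' mα : MeasurableSpace α} {η : Measure α}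
    [IsProbabilityMeasure η] (hm : m ≤ mα) (hm' : m' ≤ mα)
    (hsup : mα = m ⊔ m') (hind : Indep m m' η) {f : α → ℝ≥0∞} (hf : Measurable f)
    (hfin : ∫⁻ x, f x ∂η ≠ ∞)
    (hfac : ∀ a b, MeasurableSet[m] a → MeasurableSet[m'] b →
      ∫⁻ x in a ∩ b, f x ∂η = (∫⁻ x in a, f x ∂η) * η b) :
    Measurable[aug η m] f := by
  set g : α → ℝ≥0∞ := η⁻[f|m] with hg
  have hgm : Measurable[m] g := measurable_condLExp _ _ _
  have hgf : ∀ a, MeasurableSet[m] a → ∫⁻ x in a, g x ∂η = ∫⁻ x in a, f x ∂η :=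
    fun a ha => setLIntegral_condLExp hm _ _ ha
  have hfg : η.withDensity f = η.withDensity g := by
    have := isFiniteMeasure_withDensity hfin
    refine ext_of_generate_finite _ (hsup.trans (sup_eq_generateFrom_image2_inter m m'))
      (isPiSystem_image2_inter m m') ?_ ?_
    · rintro _ ⟨a, ha, b, hb, rfl⟩
      have hab := (hm a ha).inter (hm' b hb)
      rw [withDensity_apply _ hab, withDensity_apply _ hab, hfac a b ha hb,
        setLIntegral_inter_of_indep hm hm' hind hgm ha hb, hgf a ha]
    · rw [withDensity_apply _ .univ, withDensity_apply _ .univ, hgf _ .univ]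
  rw [withDensity_eq_iff hf.aemeasurable (hgm.mono hm le_rfl).aemeasurable hfin] at hfg
  rw [aug_eq_eventuallyMeasurableSpace]
  exact hgm.eventuallyMeasurable_of_eventuallyEq hfg

theorem aug_le_of_complete {Ω : Type*} {m mΩ : MeasurableSpace Ω} {P : Measure Ω}
    (hcomplete : ∀ s : Set Ω, P s = 0 → MeasurableSet s) (hm : m ≤ mΩ) : aug P m ≤ mΩ :=
  sup_le hm (MeasurableSpace.generateFrom_le hcomplete)

theorem IsCondKernel.measure_inter_preimage {E S Ω : Type*} [MeasurableSpace E]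
    [MeasurableSpace S] [MeasurableSpace Ω] {P : Measure Ω} {Y : Ω → E} {X : Ω → S}
    (hY : Measurable Y) (hX : Measurable X) {Θ : Kernel E S}
    (hΘ : IsCondKernel (P.map Y) (P.map fun ω => (Y ω, X ω)) Θ) {A : Set E} {C : Set S}
    (hA : MeasurableSet A) (hC : MeasurableSet C) :
    P (Y ⁻¹' A ∩ X ⁻¹' C) = ∫⁻ w in A, Θ w C ∂(P.map Y) := by
  rw [← hΘ.2 A C hA hC, Measure.map_apply (hY.prodMk hX) (hA.prod hC)]
  rfl

theorem isCondKernel_condDistrib {E S Ω : Type*} [MeasurableSpace E] [MeasurableSpace S]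
    [StandardBorelSpace S] [Nonempty S] [MeasurableSpace Ω] (P : Measure Ω)
    [IsProbabilityMeasure P] (Y : Ω → E) {X : Ω → S} (hX : Measurable X) :
    IsCondKernel (P.map Y) (P.map fun ω => (Y ω, X ω)) (condDistrib X Y P) := by
  refine ⟨inferInstance, fun A B hA hB => ?_⟩
  rw [← compProd_map_condDistrib hX.aemeasurable, Measure.compProd_apply_prod hA hB]

theorem CausalPlan.isBMWrt_sup {d : ℕ} {S Ω : Type*} [MeasurableSpace S] [MeasurableSpace Ω]
    {ℱS : unitInterval → MeasurableSpace S} (hleS : ∀ t, ℱS t ≤ ‹MeasurableSpace S›)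
    {P : Measure Ω} [IsProbabilityMeasure P] {Y : Ω → WW d} (hY : Measurable Y) {X : Ω → S}
    (hX : Measurable X)
    (hBM : IsBMWrt (fun t => aug P (MeasurableSpace.comap Y (coordF d t))) Y P)
    (hcausal : CausalPlan (coordF d) ℱS (P.map Y) (P.map fun ω => (Y ω, X ω))) :
    IsBMWrt (fun t =>
      aug P (MeasurableSpace.comap X (ℱS t)) ⊔ aug P (MeasurableSpace.comap Y (coordF d t)))
      Y P := by
  obtain ⟨-, Θ, hΘ, hΘm⟩ := hcausal
  refine ⟨fun t => (hBM.1 t).mono le_sup_right le_rfl, hBM.2.1,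
    fun s t hst => ⟨(hBM.2.2 s t hst).1, ?_⟩⟩
  set I : WW d → EuclideanSpace ℝ (Fin d) := fun w => w t - w s with hI
  have hIm : Measurable I := (by fun_prop : Continuous I).measurable
  have hIY : MeasurableSpace.comap (fun ω => Y ω t - Y ω s) inferInstance =
      (MeasurableSpace.comap I inferInstance).comap Y := by
    rw [MeasurableSpace.comap_comp]; rfl
  have hindP : Indep ((MeasurableSpace.comap I inferInstance).comap Y)
      ((coordF d s).comap Y) P := by
    rw [← hIY]
    exact indep_of_indep_of_le_right (hBM.2.2 s t hst).2 le_sup_left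
  have hind : Indep (MeasurableSpace.comap I inferInstance) (aug (P.map Y) (coordF d s))
      (P.map Y) :=
    indep_aug_right (indep_map_of_indep_comap hY hIm.comap_le (coordF_le d s) hindP)
  rw [hIY]
  refine indep_of_indep_of_le_right (indep_aug_right (m₂ := (ℱS s).comap X ⊔ (coordF d s).comap Y)
    ?_) (sup_le (aug_mono P le_sup_left) (aug_mono P le_sup_right))
  refine indep_sup_right_of_inter ((MeasurableSpace.comap_mono hIm.comap_le).trans hY.comap_le)
    ((MeasurableSpace.comap_mono (hleS s)).trans hX.comap_le)
    ((MeasurableSpace.comap_mono (coordF_le d s)).trans hY.comap_le) ?_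
  rintro _ _ _ ⟨D, hD, rfl⟩ ⟨C, hC, rfl⟩ ⟨B, hB, rfl⟩
  have hDm := hIm.comap_le D hD
  have hBm := coordF_le d s B hB
  have hCm := hleS s C hC
  have hfac := setLIntegral_inter_of_indep_aug (coordF_le d s) hIm.comap_le hind.symm
    (Θ.measurable_coe hCm) (hΘm s C hC) hB hD
  rw [← hΘ.measure_inter_preimage hY hX (hBm.inter hDm) hCm,
    ← hΘ.measure_inter_preimage hY hX hBm hCm, Measure.map_apply hY hDm] at hfac
  rw [inter_comm (X ⁻¹' C), mul_comm, ← hfac, ← inter_assoc, inter_comm (Y ⁻¹' D), preimage_inter]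

theorem causalPlan_of_isBMWrt_sup {d : ℕ} {S Ω : Type*} [MeasurableSpace S]
    [StandardBorelSpace S] [MeasurableSpace Ω] {ℱS : unitInterval → MeasurableSpace S}
    (hmonoS : Monotone ℱS) (hleS : ∀ t, ℱS t ≤ ‹MeasurableSpace S›)
    {P : Measure Ω} [IsProbabilityMeasure P]
    (hcomplete : ∀ s : Set Ω, P s = 0 → MeasurableSet s)
    {Y : Ω → WW d} (hY : Measurable Y) {X : Ω → S} (hX : Measurable X)
    (hBM : IsBMWrt (fun t =>
      aug P (MeasurableSpace.comap X (ℱS t)) ⊔ aug P (MeasurableSpace.comap Y (coordF d t)))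
      Y P) :
    CausalPlan (coordF d) ℱS (P.map Y) (P.map fun ω => (Y ω, X ω)) := by
  have : Nonempty S := P.nonempty_of_neZero.map X
  have : IsProbabilityMeasure (P.map Y) := Measure.isProbabilityMeasure_map hY.aemeasurable
  have hΘ := isCondKernel_condDistrib P Y hX
  refine ⟨Measure.fst_map_prodMk hX, condDistrib X Y P, hΘ, fun t C hC => ?_⟩
  have hCm := hleS t C hC
  have hfut := indep_iSup_increments (Z := fun t ω => Y ω t)
    (fun s t h => sup_le_sup (aug_mono P (MeasurableSpace.comap_mono (hmonoS h)))
      (aug_mono P (MeasurableSpace.comap_mono (coordF_mono d h))))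
    (fun t => sup_le
      (aug_le_of_complete hcomplete ((MeasurableSpace.comap_mono (hleS t)).trans hX.comap_le))
      (aug_le_of_complete hcomplete
        ((MeasurableSpace.comap_mono (coordF_le d t)).trans hY.comap_le)))
    hBM.1 (fun s t h => (hBM.2.2 s t h).2) t
  have hincr : (incrF d t).comap Y = ⨆ (s : unitInterval) (_ : t ≤ s),
      MeasurableSpace.comap (fun ω => Y ω s - Y ω t) inferInstance := by
    simp only [incrF, MeasurableSpace.comap_iSup, MeasurableSpace.comap_comp]
    rfl
  rw [← hincr] at hfut
  have hXle : (ℱS t).comap X ≤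
      aug P ((ℱS t).comap X) ⊔ aug P ((coordF d t).comap Y) :=
    le_sup_left.trans le_sup_left
  have hYle : (coordF d t).comap Y ≤
      aug P ((ℱS t).comap X) ⊔ aug P ((coordF d t).comap Y) :=
    le_sup_left.trans le_sup_right
  refine measurable_aug_of_factorisation (coordF_le d t) (incrF_le d t) (coordF_sup_incrF d t)
    (indep_map_of_indep_comap hY (coordF_le d t) (incrF_le d t)
      (indep_of_indep_of_le_right hfut hYle).symm) (Kernel.measurable_coe _ hCm) ?_ ?_
  · rw [← setLIntegral_univ, ← hΘ.measure_inter_preimage hY hX .univ hCm]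
    exact measure_ne_top _ _
  · intro a b ha hb
    have ham := coordF_le d t a ha
    have hbm := incrF_le d t b hb
    rw [← hΘ.measure_inter_preimage hY hX (ham.inter hbm) hCm,
      ← hΘ.measure_inter_preimage hY hX ham hCm, Measure.map_apply hY hbm, mul_comm,
      ← (Indep_iff _ _ _).1 hfut _ _ ⟨b, hb, rfl⟩
        ((hYle _ ⟨a, ha, rfl⟩).inter (hXle _ ⟨C, hC, rfl⟩)),
      preimage_inter, inter_comm (Y ⁻¹' a) (Y ⁻¹' b), inter_assoc]

/-- for `Y` a Brownian motion with respect to its own filtration and `X`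
with values in a filtered Polish space `S`, `(Y,X)` is a causal coupling iff `Y` is a
Brownian motion with respect to `σ(G_t^X ∪ G_t^Y)`. -/
theorem causal_coupling_iff_joint_BM
    {d : ℕ} {S Ω : Type*}
    [MeasurableSpace S] [TopologicalSpace S] [PolishSpace S] [BorelSpace S]
    [MeasurableSpace Ω]
    (ℱS : unitInterval → MeasurableSpace S)
    (hmonoS : Monotone ℱS) (hleS : ∀ t, ℱS t ≤ ‹MeasurableSpace S›)
    (P : Measure Ω) [IsProbabilityMeasure P]
    (hcomplete : ∀ s : Set Ω, P s = 0 → MeasurableSet s)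
    (Y : Ω → WW d) (hY : Measurable Y) (X : Ω → S) (hX : Measurable X)
    (hBM : IsBMWrt (fun t => aug P (MeasurableSpace.comap Y (coordF d t))) Y P)
    (γ : Measure (WW d × S)) (hγ : γ = P.map (fun ω => (Y ω, X ω))) :
    CausalPlan (coordF d) ℱS (P.map Y) γ ↔
      IsBMWrt (fun t =>
        aug P (MeasurableSpace.comap X (ℱS t)) ⊔ aug P (MeasurableSpace.comap Y (coordF d t)))
        Y P := by
  subst hγ
  exact ⟨fun h => h.isBMWrt_sup hleS hY hX hBM,
    fun h => causalPlan_of_isBMWrt_sup hmonoS hleS hcomplete hY hX h⟩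
end
end
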